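/- Let (f, A, C) be an a-orbit of the mini-boson-star system with parameters a > 0, α > 1, defined on [0, x̄), with (f(x), f'(x)) ≠ (0, 0) for all x, and let θ be its rotation function. Then for every nonnegative integer n, the set {x in the domain : θ(x) = nπ} has at most two elements. -/

import Mathlib

open Real Set Filter Topology MeasureTheory

noncomputable section

/-- The mini-boson-star ODE system for `f, A, C` on a set `s ⊆ (0, ∞)`
(prime denotes `d/dx`):
`(x² f'/C)' = (x²/(A C))·(1 − A C²)·f`,
`A' = (1 − A)/x − x·(A f'² + A C² f² + f²)`,
`C' = (C/(x A))·(A − 1 + x² f²)`, with `A > 0` and `C > 0`. -/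
def MiniBosonSystem (f A C : ℝ → ℝ) (s : Set ℝ) : Prop :=
  ∀ x ∈ s, 0 < x ∧ 0 < A x ∧ 0 < C x ∧
    DifferentiableAt ℝ f x ∧ DifferentiableAt ℝ (deriv f) x ∧
    DifferentiableAt ℝ A x ∧ DifferentiableAt ℝ C x ∧
    deriv (fun y => y ^ 2 * deriv f y / C y) x
      = x ^ 2 / (A x * C x) * (1 - A x * C x ^ 2) * f x ∧
    deriv A x = (1 - A x) / x
      - x * (A x * deriv f x ^ 2 + A x * C x ^ 2 * f x ^ 2 + f x ^ 2) ∧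
    deriv C x = C x / (x * A x) * (A x - 1 + x ^ 2 * f x ^ 2)

/-- A domain of the form `[0, x̄)` with `0 < x̄ ≤ ∞`. -/
def IsOrbitDomain (s : Set ℝ) : Prop :=
  s = Set.Ici (0 : ℝ) ∨ ∃ xbar > (0 : ℝ), s = Set.Ico 0 xbar

/-- An `a`-orbit of the mini-boson-star system with parameters `a, α` on the
domain `s = [0, x̄)`: a solution of the system on `s \ {0}`, continuous up to
`x = 0` with `f` differentiable at `0`, satisfying `f 0 = a`, `f' 0 = 0`,
`A 0 = 1`, `C 0 = α`. -/
def IsAOrbit (f A C : ℝ → ℝ) (a α : ℝ) (s : Set ℝ) : Prop :=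
  IsOrbitDomain s ∧
  MiniBosonSystem f A C (s \ {0}) ∧
  ContinuousWithinAt f s 0 ∧ ContinuousWithinAt A s 0 ∧ ContinuousWithinAt C s 0 ∧
  HasDerivWithinAt f 0 s 0 ∧
  f 0 = a ∧ A 0 = 1 ∧ C 0 = α

/-- The mass function `M(x) = x (1 − A x)/2`. -/
def massFn (A : ℝ → ℝ) (x : ℝ) : ℝ := x * (1 - A x) / 2

/-- `θ` is the rotation function of the orbit with scalar field `f`:
`θ` is continuous on the domain, `θ 0 = 0`, and for every `x` in the domain
there is `ρ x > 0` with `f x = ρ x · cos (θ x)` and `f' x = −ρ x · sin (θ x)`. -/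
def IsRotation (f θ : ℝ → ℝ) (s : Set ℝ) : Prop :=
  ContinuousOn θ s ∧ θ 0 = 0 ∧
  ∀ x ∈ s, ∃ ρ > (0 : ℝ), f x = ρ * Real.cos (θ x) ∧ deriv f x = -(ρ * Real.sin (θ x))

/-- If a continuous function is nonnegative at `p` and can only cross zero from negative to
positive on `[p, q]`, then it is positive at `q`. -/
lemma pos_of_upward_crossings {φ : ℝ → ℝ} {p q : ℝ} (hpq : p < q)
    (hφ : ContinuousOn φ (Icc p q)) (hp : 0 ≤ φ p)
    (hright : ∀ t ∈ Ico p q, φ t = 0 → ∀ᶠ x in 𝓝[>] t, 0 < φ x)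
    (hleft : φ q = 0 → ∀ᶠ x in 𝓝[<] q, φ x < 0) : 0 < φ q := by
  have hclosed : IsClosed ({x | 0 ≤ φ x} ∩ Icc p q) := by
    have := hφ.preimage_isClosed_of_isClosed isClosed_Icc (isClosed_Ici (a := (0 : ℝ)))
    rwa [inter_comm] at this
  have hnonneg : Icc p q ⊆ {x | 0 ≤ φ x} := by
    refine hclosed.Icc_subset_of_forall_exists_gt hp fun t ht y hy => ?_
    obtain ⟨ht0, htpq⟩ := ht
    have hev : ∀ᶠ x in 𝓝[>] t, 0 < φ x := by
      rcases (show 0 ≤ φ t from ht0).eq_or_lt with h | h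
      · exact hright t htpq h.symm
      · have hc : ContinuousWithinAt φ (Ioc t q) t :=
          (hφ t ⟨htpq.1, htpq.2.le⟩).mono fun x hx => ⟨htpq.1.trans hx.1.le, hx.2⟩
        rw [ContinuousWithinAt, nhdsWithin_Ioc_eq_nhdsGT htpq.2] at hc
        exact hc.eventually (lt_mem_nhds h)
    obtain ⟨x, hx, hxt⟩ := (hev.and (Ioc_mem_nhdsGT hy)).exists
    exact ⟨x, hx.le, hxt⟩
  refine (hnonneg (right_mem_Icc.2 hpq.le)).lt_of_ne' fun h0 => ?_
  obtain ⟨x, hx, hxt⟩ := ((hleft h0).and (Ico_mem_nhdsLT hpq)).exists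
  exact (hnonneg ⟨hxt.1, hxt.2.le⟩).not_gt hx

lemma IsOrbitDomain.nonneg {s : Set ℝ} (hs : IsOrbitDomain s) {x : ℝ} (hx : x ∈ s) : 0 ≤ x := by
  rcases hs with rfl | ⟨b, -, rfl⟩
  · exact hx
  · exact hx.1

lemma IsOrbitDomain.zero_mem {s : Set ℝ} (hs : IsOrbitDomain s) : (0 : ℝ) ∈ s := by
  rcases hs with rfl | ⟨b, hb, rfl⟩
  · exact self_mem_Ici
  · exact ⟨le_rfl, hb⟩

lemma IsOrbitDomain.ordConnected {s : Set ℝ} (hs : IsOrbitDomain s) : s.OrdConnected := by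
  rcases hs with rfl | ⟨b, -, rfl⟩
  · exact ordConnected_Ici
  · exact ordConnected_Ico

section Orbit

variable {f A C θ : ℝ → ℝ} {a α : ℝ} {s : Set ℝ}

lemma IsAOrbit.system_of_pos (h : IsAOrbit f A C a α s) {x : ℝ} (hx : x ∈ s) (h0 : 0 < x) :
    0 < A x ∧ 0 < C x ∧
    DifferentiableAt ℝ f x ∧ DifferentiableAt ℝ (deriv f) x ∧
    DifferentiableAt ℝ A x ∧ DifferentiableAt ℝ C x ∧
    deriv (fun y => y ^ 2 * deriv f y / C y) x
      = x ^ 2 / (A x * C x) * (1 - A x * C x ^ 2) * f x ∧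
    deriv A x = (1 - A x) / x
      - x * (A x * deriv f x ^ 2 + A x * C x ^ 2 * f x ^ 2 + f x ^ 2) ∧
    deriv C x = C x / (x * A x) * (A x - 1 + x ^ 2 * f x ^ 2) :=
  (h.2.1 x ⟨hx, h0.ne'⟩).2

lemma IsAOrbit.continuousOn (h : IsAOrbit f A C a α s) :
    ContinuousOn f s ∧ ContinuousOn A s ∧ ContinuousOn C s := by
  refine ⟨fun x hx => ?_, fun x hx => ?_, fun x hx => ?_⟩ <;>
    rcases (h.1.nonneg hx).eq_or_lt with rfl | h0
  · exact h.2.2.1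
  · exact (h.system_of_pos hx h0).2.2.1.continuousAt.continuousWithinAt
  · exact h.2.2.2.1
  · exact (h.system_of_pos hx h0).2.2.2.2.1.continuousAt.continuousWithinAt
  · exact h.2.2.2.2.1
  · exact (h.system_of_pos hx h0).2.2.2.2.2.1.continuousAt.continuousWithinAt

lemma IsAOrbit.C_pos (h : IsAOrbit f A C a α s) (hα : 0 < α) {x : ℝ} (hx : x ∈ s) : 0 < C x := by
  rcases (h.1.nonneg hx).eq_or_lt with rfl | h0
  · rwa [h.2.2.2.2.2.2.2.2]
  · exact (h.system_of_pos hx h0).2.1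

/-- Away from zeros of `cos θ`, `f' = -f tan θ`, so continuity of the rotation function makes
`f'` continuous up to `x = 0`. -/
lemma IsAOrbit.continuousOn_deriv (h : IsAOrbit f A C a α s) (hθ : IsRotation f θ s) :
    ContinuousOn (deriv f) s := by
  intro x hx
  rcases (h.1.nonneg hx).eq_or_lt with rfl | h0
  · have hcos0 : Real.cos (θ 0) ≠ 0 := by
      rw [hθ.2.1, Real.cos_zero]
      exact one_ne_zero
    have hcos : ContinuousWithinAt (fun y => Real.cos (θ y)) s 0 :=
      Real.continuous_cos.continuousAt.comp_continuousWithinAt (hθ.1 0 hx)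
    have htan : ContinuousWithinAt (fun y => -(f y) * Real.tan (θ y)) s 0 :=
      h.2.2.1.neg.mul <| ContinuousAt.comp_continuousWithinAt (g := Real.tan)
        (Real.continuousAt_tan.2 hcos0) (hθ.1 0 hx)
    have hformula : ∀ y ∈ s, Real.cos (θ y) ≠ 0 → deriv f y = -(f y) * Real.tan (θ y) := by
      intro y hy hc
      obtain ⟨ρ, -, hf, hf'⟩ := hθ.2.2 y hy
      rw [hf', hf, Real.tan_eq_sin_div_cos]
      field_simp
    have hev : ∀ᶠ y in 𝓝[s] 0, Real.cos (θ y) ≠ 0 := hcos.eventually_ne hcos0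
    refine htan.congr_of_eventuallyEq ?_ (hformula 0 hx hcos0)
    filter_upwards [hev, self_mem_nhdsWithin] with y hy hys using hformula y hys hy
  · exact (h.system_of_pos hx h0).2.2.2.1.continuousAt.continuousWithinAt

/-- The mass function is strictly increasing from `0`, hence `A < 1` away from the origin. -/
lemma IsAOrbit.A_lt_one (h : IsAOrbit f A C a α s)
    (hnv : ∀ x ∈ s, (f x, deriv f x) ≠ (0, 0)) {x : ℝ} (hx : x ∈ s) (h0 : 0 < x) : A x < 1 := by
  have hsub : Icc 0 x ⊆ s := h.1.ordConnected.out h.1.zero_mem hx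
  have hmono : StrictMonoOn (massFn A) (Icc 0 x) := by
    refine strictMonoOn_of_deriv_pos (convex_Icc 0 x) ?_ ?_
    · exact (continuousOn_id.mul (continuousOn_const.sub (h.continuousOn.2.1.mono hsub))).div_const 2
    · intro y hy
      rw [interior_Icc] at hy
      have hys : y ∈ s := hsub ⟨hy.1.le, hy.2.le⟩
      have hy0 : 0 < y := hy.1
      obtain ⟨hA, hC, -, -, hdA, -, -, hA', -⟩ := h.system_of_pos hys hy0
      have hd : HasDerivAt (massFn A) ((1 * (1 - A y) + y * -(deriv A y)) / 2) y :=
        ((hasDerivAt_id y).mul (hdA.hasDerivAt.const_sub 1)).div_const 2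
      have heq : (1 * (1 - A y) + y * -(deriv A y)) / 2
          = y ^ 2 * (A y * deriv f y ^ 2 + A y * C y ^ 2 * f y ^ 2 + f y ^ 2) / 2 := by
        rw [hA']
        field_simp
        ring
      rw [hd.deriv, heq]
      have hsum : 0 < A y * deriv f y ^ 2 + A y * C y ^ 2 * f y ^ 2 + f y ^ 2 := by
        by_cases hf : f y = 0
        · have hf' : deriv f y ≠ 0 := fun hf' => hnv y hys (by rw [hf, hf'])
          positivity
        · positivity
      positivity
  have hM := hmono (left_mem_Icc.2 h0.le) (right_mem_Icc.2 h0.le) h0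
  simp only [massFn, zero_mul, zero_div] at hM
  have : 0 < x * (1 - A x) := by linarith
  linarith [pos_of_mul_pos_right this h0.le]

/-- Once `A C² ≤ 1`, it stays strictly below `1`. -/
lemma IsAOrbit.mul_sq_lt_one (h : IsAOrbit f A C a α s)
    (hnv : ∀ x ∈ s, (f x, deriv f x) ≠ (0, 0)) {y z : ℝ} (hy : y ∈ s) (hz : z ∈ s)
    (hy0 : 0 < y) (hyz : y < z) (hle : A y * C y ^ 2 ≤ 1) : A z * C z ^ 2 < 1 := by
  have hsub : Icc y z ⊆ s := h.1.ordConnected.out hy hz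
  have hderiv : ∀ t ∈ Icc y z, 1 - A t * C t ^ 2 = 0 →
      ∃ d > 0, HasDerivAt (fun x => 1 - A x * C x ^ 2) d t := by
    intro t ht ht0
    have ht_pos : 0 < t := hy0.trans_le ht.1
    obtain ⟨hA, hC, -, -, hdA, hdC, -, hA', hC'⟩ := h.system_of_pos (hsub ht) ht_pos
    have hA1 := h.A_lt_one hnv (hsub ht) ht_pos
    refine ⟨_, ?_, (hdA.hasDerivAt.mul (hdC.hasDerivAt.pow 2)).const_sub 1⟩
    have heq : -(deriv A t * C t ^ 2 + A t * (2 * C t * deriv C t))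
        = C t ^ 2 * ((1 - A t) / t + t * A t * deriv f t ^ 2
          - t * f t ^ 2 * (1 - A t * C t ^ 2)) := by
      rw [hA', hC']
      field_simp
      ring
    have hpos : 0 < C t ^ 2 * ((1 - A t) / t + t * A t * deriv f t ^ 2) := by
      have := div_pos (sub_pos.2 hA1) ht_pos
      positivity
    rw [ht0, mul_zero, sub_zero] at heq
    rw [← heq] at hpos
    simpa using hpos
  have hpos : 0 < 1 - A z * C z ^ 2 := by
    refine pos_of_upward_crossings (φ := fun x => 1 - A x * C x ^ 2) hyz ?_ (by linarith) ?_ ?_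
    · exact continuousOn_const.sub
        ((h.continuousOn.2.1.mono hsub).mul ((h.continuousOn.2.2.mono hsub).pow 2))
    · intro t ht ht0
      obtain ⟨d, hd, hdt⟩ := hderiv t ⟨ht.1, ht.2.le⟩ ht0
      have := (hasDerivWithinAt_iff_tendsto_slope' (notMem_Ioi.2 le_rfl)).1
        (hdt.hasDerivWithinAt (s := Ioi t))
      filter_upwards [this.eventually (lt_mem_nhds hd), self_mem_nhdsWithin] with x hx hxt
      rw [slope_def_field, ht0, sub_zero] at hx
      exact (div_pos_iff_of_pos_right (sub_pos.2 hxt)).1 hx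
    · intro hz0
      obtain ⟨d, hd, hdt⟩ := hderiv z (right_mem_Icc.2 hyz.le) hz0
      have := (hasDerivWithinAt_iff_tendsto_slope' (notMem_Iio.2 le_rfl)).1
        (hdt.hasDerivWithinAt (s := Iio z))
      filter_upwards [this.eventually (lt_mem_nhds hd), self_mem_nhdsWithin] with x hx hxt
      rw [slope_def_field, hz0, sub_zero] at hx
      exact (div_pos_iff.1 hx).elim (fun hh => absurd hh.2 (sub_neg.2 hxt).not_gt) And.left
  linarith

/-- Monotonicity of the flux `x² f' / C`, weighted by `k`, on an interval where `A C² - 1` has the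
sign of `σ` and `f` has the sign of `k`. -/
lemma IsAOrbit.flux_lt (h : IsAOrbit f A C a α s) (hα : 0 < α) (hθ : IsRotation f θ s)
    {p q σ k : ℝ} (hp : p ∈ s) (hq : q ∈ s) (hpq : p < q)
    (hσ : ∀ x ∈ Ioo p q, 0 < σ * (A x * C x ^ 2 - 1)) (hk : ∀ x ∈ Ioo p q, 0 < k * f x) :
    σ * k * (q ^ 2 * deriv f q / C q) < σ * k * (p ^ 2 * deriv f p / C p) := by
  have hsub : Icc p q ⊆ s := h.1.ordConnected.out hp hq
  have hanti : StrictAntiOn (fun x => σ * k * (x ^ 2 * deriv f x / C x)) (Icc p q) := by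
    refine strictAntiOn_of_deriv_neg (convex_Icc p q) ?_ ?_
    · refine continuousOn_const.mul (ContinuousOn.div ?_ (h.continuousOn.2.2.mono hsub)
        fun x hx => (h.C_pos hα (hsub hx)).ne')
      exact (continuousOn_id.pow 2).mul ((h.continuousOn_deriv hθ).mono hsub)
    · intro x hx
      rw [interior_Icc] at hx
      have hx0 : 0 < x := (h.1.nonneg hp).trans_lt hx.1
      obtain ⟨hA, hC, -, -, -, -, hflux, -, -⟩ :=
        h.system_of_pos (hsub ⟨hx.1.le, hx.2.le⟩) hx0
      rw [deriv_const_mul_field, hflux]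
      have hpos : 0 < x ^ 2 / (A x * C x) * (σ * (A x * C x ^ 2 - 1)) * (k * f x) := by
        have := hσ x hx
        have := hk x hx
        positivity
      linarith
  exact hanti (left_mem_Icc.2 hpq.le) (right_mem_Icc.2 hpq.le) hpq

/-- Near a point `t` with `θ t = nπ`, `f` does not change sign and `θ - nπ` has the sign
of `-f(t) f'`. -/
lemma IsAOrbit.exists_sign_control (h : IsAOrbit f A C a α s) (hθ : IsRotation f θ s)
    {n : ℕ} {t : ℝ} (ht : t ∈ s) (hn : θ t = n * π) :
    ∃ ε > 0, ∀ x ∈ s, |x - t| < ε → 0 < f t * f x ∧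
      ∀ σ : ℝ, 0 < σ * f t * -deriv f x → 0 < σ * (θ x - n * π) := by
  have hft : f t ≠ 0 := by
    obtain ⟨ρ, hρ, hf, -⟩ := hθ.2.2 t ht
    rw [hf, hn]
    refine mul_ne_zero hρ.ne' fun hc => ?_
    have := Real.sin_sq_add_cos_sq (n * π)
    rw [hc, Real.sin_nat_mul_pi] at this
    norm_num at this
  have h1 : ∀ᶠ x in 𝓝[s] t, 0 < f t * f x :=
    (continuousWithinAt_const.mul (h.continuousOn.1 t ht)).eventually
      (lt_mem_nhds (mul_self_pos.2 hft))
  have h2 : ∀ᶠ x in 𝓝[s] t, |θ x - n * π| < π / 2 := by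
    have := ((hθ.1 t ht).sub (continuousWithinAt_const (b := n * π))).abs
    refine this.eventually (gt_mem_nhds ?_)
    simpa [hn] using pi_pos
  obtain ⟨ε, hε, hball⟩ := Metric.mem_nhdsWithin_iff.1 (h1.and h2)
  refine ⟨ε, hε, fun x hx hxt => ?_⟩
  obtain ⟨hfx, hθx⟩ := hball ⟨by rwa [Metric.mem_ball, Real.dist_eq], hx⟩
  refine ⟨hfx, fun σ hσ => ?_⟩
  obtain ⟨ρ, hρ, hf, hf'⟩ := hθ.2.2 x hx
  set u := θ x - n * π with hu
  have hu' : θ x = u + n * π := by rw [hu]; ring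
  have hcos : 0 < Real.cos u := Real.cos_pos_of_mem_Ioo (abs_lt.1 hθx |>.imp (by intro; linarith) id)
  have hprod : f x * -deriv f x = ρ ^ 2 * (Real.sin u * Real.cos u) := by
    rw [hf, hf', hu', Real.cos_add_nat_mul_pi, Real.sin_add_nat_mul_pi]
    have : ((-1 : ℝ) ^ n) * (-1) ^ n = 1 := by rw [← mul_pow]; simp
    linear_combination ρ ^ 2 * Real.sin u * Real.cos u * this
  have hsin : 0 < σ * Real.sin u := by
    have hmul : 0 < (f t) ^ 2 * (ρ ^ 2 * Real.cos u) * (σ * Real.sin u) := by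
      have := mul_pos hσ hfx
      calc (0 : ℝ) < σ * f t * -deriv f x * (f t * f x) := this
        _ = f t ^ 2 * σ * (f x * -deriv f x) := by ring
        _ = _ := by rw [hprod]; ring
    exact pos_of_mul_pos_right hmul (by positivity)
  obtain ⟨hu1, hu2⟩ := abs_lt.1 hθx
  have hpi := pi_pos
  rcases lt_trichotomy u 0 with h0 | h0 | h0
  · have : Real.sin u < 0 := Real.sin_neg_of_neg_of_neg_pi_lt h0 (by linarith)
    exact mul_pos_of_neg_of_neg (by nlinarith) h0
  · simp [h0] at hsin
  · have : 0 < Real.sin u := Real.sin_pos_of_pos_of_lt_pi h0 (by linarith)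
    exact mul_pos (by nlinarith) h0

/-- `θ` takes the value `nπ` at most once on an interval inside which `A C² ≠ 1`. -/
lemma IsAOrbit.not_hits_twice (h : IsAOrbit f A C a α s) (hα : 0 < α) (hθ : IsRotation f θ s)
    {n : ℕ} {p q σ : ℝ} (hp : p ∈ s) (hq : q ∈ s) (hpq : p < q)
    (hσ : ∀ x ∈ Ioo p q, 0 < σ * (A x * C x ^ 2 - 1))
    (hnp : θ p = n * π) (hnq : θ q = n * π) : False := by
  have hsub : Icc p q ⊆ s := h.1.ordConnected.out hp hq
  have hσ0 : σ ≠ 0 := by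
    rintro rfl
    obtain ⟨x, hx⟩ := exists_between hpq
    simpa using hσ x hx
  have hdzero : ∀ t ∈ s, θ t = n * π → deriv f t = 0 := by
    intro t ht hn
    obtain ⟨ρ, -, -, hf'⟩ := hθ.2.2 t ht
    rw [hf', hn, Real.sin_nat_mul_pi, mul_zero, neg_zero]
  have hpos : 0 < σ * (θ q - n * π) := by
    refine pos_of_upward_crossings (φ := fun x => σ * (θ x - n * π)) hpq ?_ (by simp [hnp]) ?_ ?_
    · exact continuousOn_const.mul ((hθ.1.mono hsub).sub continuousOn_const)
    · intro t ht ht0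
      have hts := hsub ⟨ht.1, ht.2.le⟩
      have hnt : θ t = n * π := sub_eq_zero.1 ((mul_eq_zero.1 ht0).resolve_left hσ0)
      obtain ⟨ε, hε, hctl⟩ := h.exists_sign_control hθ hts hnt
      filter_upwards [Ioo_mem_nhdsGT (lt_min ht.2 (lt_add_of_pos_right t hε))] with x hx
      have hxq := hx.2.trans_le (min_le_left _ _)
      have hxε := hx.2.trans_le (min_le_right _ _)
      have hxs : x ∈ s := hsub ⟨ht.1.trans hx.1.le, hxq.le⟩
      have hflux := h.flux_lt hα hθ (σ := σ) (k := f t) hts hxs hx.1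
        (fun y hy => hσ y ⟨ht.1.trans_lt hy.1, hy.2.trans hxq⟩)
        (fun y hy => (hctl y (hsub ⟨ht.1.trans hy.1.le, (hy.2.trans hxq).le⟩)
          (by rw [abs_of_pos (sub_pos.2 hy.1)]; linarith [hy.2])).1)
      rw [hdzero t hts hnt, mul_zero, zero_div, mul_zero] at hflux
      refine (hctl x hxs (by rw [abs_of_pos (sub_pos.2 hx.1)]; linarith)).2 σ ?_
      have hx0 : 0 < x := (h.1.nonneg hts).trans_lt hx.1
      have hC := h.C_pos hα hxs
      have : 0 < x ^ 2 / C x * (σ * f t * -deriv f x) := by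
        calc (0 : ℝ) < -(σ * f t * (x ^ 2 * deriv f x / C x)) := by linarith
          _ = _ := by ring
      exact pos_of_mul_pos_right this (by positivity)
    · intro _
      obtain ⟨ε, hε, hctl⟩ := h.exists_sign_control hθ hq hnq
      filter_upwards [Ioo_mem_nhdsLT (max_lt hpq (sub_lt_self q hε))] with x hx
      have hpx := (le_max_left _ _).trans_lt hx.1
      have hxε := (le_max_right _ _).trans_lt hx.1
      have hxs : x ∈ s := hsub ⟨hpx.le, hx.2.le⟩
      have hflux := h.flux_lt hα hθ (σ := σ) (k := f q) hxs hq hx.2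
        (fun y hy => hσ y ⟨hpx.trans hy.1, hy.2⟩)
        (fun y hy => (hctl y (hsub ⟨(hpx.trans hy.1).le, hy.2.le⟩)
          (by rw [abs_of_neg (sub_neg.2 hy.2)]; linarith [hy.1])).1)
      rw [hdzero q hq hnq, mul_zero, zero_div, mul_zero] at hflux
      have hx0 : 0 < x := (h.1.nonneg hp).trans_lt hpx
      have hC := h.C_pos hα hxs
      have hneg : 0 < -σ * (θ x - n * π) := by
        refine (hctl x hxs (by rw [abs_of_neg (sub_neg.2 hx.2)]; linarith)).2 (-σ) ?_
        have : 0 < x ^ 2 / C x * (-σ * f q * -deriv f x) := by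
          calc (0 : ℝ) < σ * f q * (x ^ 2 * deriv f x / C x) := hflux
            _ = _ := by ring
        exact pos_of_mul_pos_right this (by positivity)
      linarith
  simp [hnq] at hpos

lemma IsAOrbit.not_hits_thrice (h : IsAOrbit f A C a α s) (hα : 0 < α)
    (hnv : ∀ x ∈ s, (f x, deriv f x) ≠ (0, 0)) (hθ : IsRotation f θ s) {n : ℕ} {x y z : ℝ}
    (hx : x ∈ s) (hy : y ∈ s) (hz : z ∈ s) (hxy : x < y) (hyz : y < z)
    (hnx : θ x = n * π) (hny : θ y = n * π) (hnz : θ z = n * π) : False := by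
  have hy0 : 0 < y := (h.1.nonneg hx).trans_lt hxy
  rcases le_or_gt (A y * C y ^ 2) 1 with hle | hgt
  · refine h.not_hits_twice hα hθ (σ := -1) hy hz hyz (fun t ht => ?_) hny hnz
    have := h.mul_sq_lt_one hnv hy (h.1.ordConnected.out hy hz ⟨ht.1.le, ht.2.le⟩) hy0 ht.1 hle
    linarith
  · refine h.not_hits_twice hα hθ (σ := 1) hx hy hxy (fun t ht => ?_) hnx hny
    by_contra! hle
    have := h.mul_sq_lt_one hnv (h.1.ordConnected.out hx hy ⟨ht.1.le, ht.2.le⟩) hy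
      ((h.1.nonneg hx).trans_lt ht.1) ht.2 (by linarith)
    linarith

end Orbit

/-- The rotation function of an `a`-orbit takes the value `nπ` at most twice:
there are at most two points `x` in the domain with `θ x = nπ`. -/
theorem rotation_hits_npi_at_most_twice (f A C θ : ℝ → ℝ) (a α : ℝ) (s : Set ℝ)
    (ha : 0 < a) (hα : 1 < α) (horbit : IsAOrbit f A C a α s)
    (hnv : ∀ x ∈ s, (f x, deriv f x) ≠ (0, 0))
    (hθ : IsRotation f θ s) (n : ℕ) :
    ∃ u v : ℝ, ∀ x ∈ s, θ x = (n : ℝ) * Real.pi → x = u ∨ x = v := by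
  by_contra! hcon
  obtain ⟨x, hx, hnx, -, -⟩ := hcon 0 0
  obtain ⟨y, hy, hny, hyx, -⟩ := hcon x x
  obtain ⟨z, hz, hnz, hzx, hzy⟩ := hcon x y
  have key := fun {x y z : ℝ} =>
    horbit.not_hits_thrice (zero_lt_one.trans hα) hnv hθ (n := n) (x := x) (y := y) (z := z)
  rcases hyx.lt_or_gt with h1 | h1 <;> rcases hzx.lt_or_gt with h2 | h2 <;>
    rcases hzy.lt_or_gt with h3 | h3
  · exact key hz hy hx h3 h1 hnz hny hnx
  · exact key hy hz hx h3 h2 hny hnz hnx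
  · exact (h1.trans h2).not_gt h3
  · exact key hy hx hz h1 h2 hny hnx hnz
  · exact key hz hx hy h2 h1 hnz hnx hny
  · exact (h2.trans h1).not_gt h3
  · exact key hx hz hy h2 h3 hnx hnz hny
  · exact key hx hy hz h1 h3 hnx hny hnz
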